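/- Let μ, α, β, σ > 0 and r ≥ 3 with, in case r = 3, the additional condition 2βμ ≥ 1, and let g ∈ C_c^∞(ℝ³; ℝ³) be divergence-free. There exist constants R̃, C* > 0, depending only on μ, α, β, σ, r and g, such that the following holds. Let y : ℝ → ℝ be continuous, let f : ℝ × ℝ³ → ℝ³ be continuous with ∫_{ℝ³}|f(t,x)|² dx < ∞ for every t, let u : ℝ × ℝ³ → ℝ³ be smooth with, for each bounded time interval, a single compact set K ⊂ ℝ³ containing the support of u(t,·) for all t in that interval, let u(t,·) be divergence-free for every t, and let p : ℝ × ℝ³ → ℝ be continuously differentiable in x, such that ∂u/∂t − μΔu + ((u + g y(t))·∇)(u + g y(t)) + αu + β|u + g y(t)|^{r−1}(u + g y(t)) = −∇p + f + (σ − α) g y(t) + μ y(t) Δg holds pointwise on ℝ × ℝ³. Then the function G(t) := ∫_{ℝ³}|∇u(t,x)|² dx is differentiable and for every t: G′(t) + α G(t) + (C*/2) (∫_{ℝ³}|u(t,x) + g(x) y(t)|^{3(r+1)} dx)^{1/3} ≤ R̃ ( ∫_{ℝ³}|f(t,x)|² dx + ∫_{ℝ³}|u(t,x)|² dx + ∫_{ℝ³}|∇u(t,x)|²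 dx + ∫_{ℝ³}|u(t,x) + g(x) y(t)|^{r+1} dx + |y(t)|² + |y(t)|^{r+1} ). -/

import Mathlib

open MeasureTheory Filter

noncomputable section

/-- ℝ³ as a Euclidean space. -/
abbrev E3 : Type := EuclideanSpace ℝ (Fin 3)

/-- Partial derivative `∂g/∂xᵢ` of a scalar function on ℝ³. -/
def pd (i : Fin 3) (g : E3 → ℝ) (x : E3) : ℝ :=
  fderiv ℝ g x (EuclideanSpace.single i 1)

/-- The Laplacian of a scalar function on ℝ³. -/
def lap (g : E3 → ℝ) (x : E3) : ℝ :=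
  ∑ i : Fin 3, pd i (fun y => pd i g y) x

/-- `|∇v|² = ∑_{i,j} (∂vⱼ/∂xᵢ)²` for a vector field on ℝ³. -/
def gradSq (v : E3 → E3) (x : E3) : ℝ :=
  ∑ i : Fin 3, ∑ j : Fin 3, (pd i (fun y => v y j) x) ^ 2

section Calculus

variable {φ ψ : E3 → ℝ}

theorem ContDiff.partialDeriv (hφ : ContDiff ℝ (⊤ : ℕ∞) φ) (i : Fin 3) :
    ContDiff ℝ (⊤ : ℕ∞) (pd i φ) :=
  (hφ.fderiv_right (m := (⊤ : ℕ∞)) (by simp)).clm_apply contDiff_const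

theorem ContDiff.continuous_partialDeriv (hφ : ContDiff ℝ 1 φ) (i : Fin 3) : Continuous (pd i φ) :=
  (hφ.continuous_fderiv one_ne_zero).clm_apply continuous_const

theorem HasCompactSupport.partialDeriv (hφ : HasCompactSupport φ) (i : Fin 3) :
    HasCompactSupport (pd i φ) :=
  hφ.fderiv_apply ℝ _

theorem ContDiff.laplacian (hφ : ContDiff ℝ (⊤ : ℕ∞) φ) : ContDiff ℝ (⊤ : ℕ∞) (lap φ) :=
  ContDiff.sum fun i _ => (hφ.partialDeriv i).partialDeriv i

theorem HasCompactSupport.fun_sum {ι X : Type*} [TopologicalSpace X] {s : Finset ι}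
    {F : ι → X → ℝ} (hF : ∀ i, HasCompactSupport (F i)) :
    HasCompactSupport (fun x => ∑ i ∈ s, F i x) := by
  simpa only [← Finset.sum_fn] using HasCompactSupport.finset_sum (s := s) fun i _ => hF i

theorem HasCompactSupport.fun_sq (hφ : HasCompactSupport φ) :
    HasCompactSupport (fun x => φ x ^ 2) :=
  hφ.mono fun x hx h => hx (by simp [h])

theorem HasCompactSupport.laplacian (hφ : HasCompactSupport φ) : HasCompactSupport (lap φ) :=
  HasCompactSupport.fun_sum fun i => (hφ.partialDeriv i).partialDeriv i

theorem pd_add {x : E3} (i : Fin 3) (hφ : DifferentiableAt ℝ φ x) (hψ : DifferentiableAt ℝ ψ x) :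
    pd i (fun y => φ y + ψ y) x = pd i φ x + pd i ψ x := by
  simp [pd, fderiv_fun_add hφ hψ]

theorem pd_sum {ι : Type*} {s : Finset ι} {F : ι → E3 → ℝ} {x : E3} (i : Fin 3)
    (hF : ∀ j, DifferentiableAt ℝ (F j) x) :
    pd i (fun y => ∑ j ∈ s, F j y) x = ∑ j ∈ s, pd i (F j) x := by
  simp [pd, fderiv_fun_sum fun j _ => hF j]

theorem pd_mul_const {x : E3} (i : Fin 3) (c : ℝ) (hφ : DifferentiableAt ℝ φ x) :
    pd i (fun y => φ y * c) x = pd i φ x * c := by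
  simp only [pd, fderiv_mul_const hφ]
  simp [mul_comm]

theorem pd_mul {x : E3} (i : Fin 3) (hφ : DifferentiableAt ℝ φ x) (hψ : DifferentiableAt ℝ ψ x) :
    pd i (fun y => φ y * ψ y) x = φ x * pd i ψ x + pd i φ x * ψ x := by
  simp [pd, fderiv_fun_mul hφ hψ, mul_comm]

theorem fderiv_fderiv_apply_comm {E : Type*} [NormedAddCommGroup E] [NormedSpace ℝ E]
    {h : E → ℝ} (hh : ContDiff ℝ (⊤ : ℕ∞) h) (a b x : E) :
    fderiv ℝ (fun y => fderiv ℝ h y a) x b = fderiv ℝ (fun y => fderiv ℝ h y b) x a := by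
  have hd : DifferentiableAt ℝ (fderiv ℝ h) x :=
    ((hh.fderiv_right (m := (⊤ : ℕ∞)) (by simp)).differentiable (by simp)) x
  have hs : IsSymmSndFDerivAt ℝ h x :=
    hh.contDiffAt.isSymmSndFDerivAt (by simpa using WithTop.coe_le_coe.2 (le_top (a := (2 : ℕ∞))))
  rw [fderiv_clm_apply hd (by fun_prop), fderiv_clm_apply hd (by fun_prop)]
  simpa using hs b a

theorem pd_pd_comm (hφ : ContDiff ℝ (⊤ : ℕ∞) φ) (i j : Fin 3) :
    pd i (pd j φ) = pd j (pd i φ) :=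
  funext fun x => fderiv_fderiv_apply_comm hφ _ _ x

theorem lap_add (hφ : ContDiff ℝ (⊤ : ℕ∞) φ) (hψ : ContDiff ℝ (⊤ : ℕ∞) ψ) (x : E3) :
    lap (fun y => φ y + ψ y) x = lap φ x + lap ψ x := by
  have h (i : Fin 3) : pd i (fun y => φ y + ψ y) = fun y => pd i φ y + pd i ψ y :=
    funext fun y => pd_add i (hφ.differentiable (by simp) y) (hψ.differentiable (by simp) y)
  simp only [lap, h, ← Finset.sum_add_distrib]
  exact Finset.sum_congr rfl fun i _ =>
    pd_add i ((hφ.partialDeriv i).differentiable (by simp) x)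
      ((hψ.partialDeriv i).differentiable (by simp) x)

theorem lap_mul_const (hφ : ContDiff ℝ (⊤ : ℕ∞) φ) (c : ℝ) (x : E3) :
    lap (fun y => φ y * c) x = lap φ x * c := by
  have h (i : Fin 3) : pd i (fun y => φ y * c) = fun y => pd i φ y * c :=
    funext fun y => pd_mul_const i c (hφ.differentiable (by simp) y)
  simp only [lap, h, Finset.sum_mul]
  exact Finset.sum_congr rfl fun i _ =>
    pd_mul_const i c ((hφ.partialDeriv i).differentiable (by simp) x)

theorem pd_lap (hφ : ContDiff ℝ (⊤ : ℕ∞) φ) (j : Fin 3) (x : E3) :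
    pd j (lap φ) x = lap (pd j φ) x := by
  have h : lap φ = fun y => ∑ i : Fin 3, pd i (pd i φ) y := rfl
  rw [h, pd_sum j fun i => (((hφ.partialDeriv i).partialDeriv i).differentiable (by simp) x)]
  refine Finset.sum_congr rfl fun i _ => ?_
  rw [pd_pd_comm (hφ.partialDeriv i), pd_pd_comm hφ j i]

theorem integral_mul_pd (hφ : ContDiff ℝ 1 φ) (hψ : ContDiff ℝ 1 ψ) (hc : HasCompactSupport ψ)
    (i : Fin 3) : ∫ x, φ x * pd i ψ x = -∫ x, pd i φ x * ψ x :=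
  integral_mul_fderiv_eq_neg_fderiv_mul_of_integrable
    (((hφ.continuous_partialDeriv i).mul hψ.continuous).integrable_of_hasCompactSupport hc.mul_left)
    ((hφ.continuous.mul (hψ.continuous_partialDeriv i)).integrable_of_hasCompactSupport
      (hc.partialDeriv i).mul_left)
    ((hφ.continuous.mul hψ.continuous).integrable_of_hasCompactSupport hc.mul_left)
    (fun x _ => hφ.differentiable one_ne_zero x) (fun x _ => hψ.differentiable one_ne_zero x)

theorem integral_mul_lap (hφ : ContDiff ℝ 1 φ) (hψ : ContDiff ℝ (⊤ : ℕ∞) ψ)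
    (hc : HasCompactSupport ψ) :
    ∫ x, φ x * lap ψ x = -∫ x, ∑ i : Fin 3, pd i φ x * pd i ψ x := by
  have h1 (i : Fin 3) : Integrable fun x => φ x * pd i (pd i ψ) x :=
    (hφ.continuous.mul ((hψ.partialDeriv i).partialDeriv i).continuous).integrable_of_hasCompactSupport
      ((hc.partialDeriv i).partialDeriv i).mul_left
  have h2 (i : Fin 3) : Integrable fun x => pd i φ x * pd i ψ x :=
    ((hφ.continuous_partialDeriv i).mul (hψ.partialDeriv i).continuous).integrable_of_hasCompactSupport
      (hc.partialDeriv i).mul_left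
  have h3 (x : E3) : φ x * lap ψ x = ∑ i : Fin 3, φ x * pd i (pd i ψ) x := Finset.mul_sum ..
  simp_rw [h3]
  rw [integral_finsetSum _ fun i _ => h1 i, integral_finsetSum _ fun i _ => h2 i,
    ← Finset.sum_neg_distrib]
  exact Finset.sum_congr rfl fun i _ =>
    integral_mul_pd hφ ((hψ.partialDeriv i).of_le (by simp)) (hc.partialDeriv i) i

theorem integral_grad_inner_lap_eq_zero {p : E3 → ℝ} (hp : ContDiff ℝ 1 p) {w : Fin 3 → E3 → ℝ}
    (hw : ∀ j, ContDiff ℝ (⊤ : ℕ∞) (w j)) (hc : ∀ j, HasCompactSupport (w j))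
    (hdiv : ∀ x, ∑ j, pd j (w j) x = 0) :
    ∫ x, ∑ j, pd j p x * lap (w j) x = 0 := by
  have h1 (j : Fin 3) : Integrable fun x => pd j p x * lap (w j) x :=
    ((hp.continuous_partialDeriv j).mul (hw j).laplacian.continuous).integrable_of_hasCompactSupport
      (hc j).laplacian.mul_left
  have h2 (j : Fin 3) : Integrable fun x => p x * pd j (lap (w j)) x :=
    (hp.continuous.mul ((hw j).laplacian.partialDeriv j).continuous).integrable_of_hasCompactSupport
      ((hc j).laplacian.partialDeriv j).mul_left
  have h3 (j : Fin 3) : ∫ x, pd j p x * lap (w j) x = -∫ x, p x * pd j (lap (w j)) x := by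
    rw [integral_mul_pd hp ((hw j).laplacian.of_le (by simp)) (hc j).laplacian j, neg_neg]
  rw [integral_finsetSum _ fun j _ => h1 j, Finset.sum_congr rfl fun j _ => h3 j,
    Finset.sum_neg_distrib, ← integral_finsetSum _ fun j _ => h2 j, neg_eq_zero]
  have h4 (x : E3) : ∑ j, p x * pd j (lap (w j)) x = 0 := by
    have h5 (i : Fin 3) : ∑ j, pd i (pd i (pd j (w j))) x = 0 := by
      have e1 : pd i (fun y => ∑ j, pd j (w j) y) = fun y => ∑ j, pd i (pd j (w j)) y :=
        funext fun y => pd_sum i fun j => ((hw j).partialDeriv j).differentiable (by simp) y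
      have e2 : pd i (pd i (fun y => ∑ j, pd j (w j) y)) x = ∑ j, pd i (pd i (pd j (w j))) x := by
        rw [e1]
        exact pd_sum i fun j => (((hw j).partialDeriv j).partialDeriv i).differentiable (by simp) x
      have e3 : (fun y => ∑ j, pd j (w j) y) = fun _ => 0 := funext hdiv
      have e4 (i : Fin 3) : pd i (fun _ : E3 => (0 : ℝ)) = fun _ => 0 := by
        funext y; simp [pd]
      rw [← e2, e3, e4, e4]
    have h6 (j : Fin 3) : pd j (lap (w j)) x = ∑ i, pd i (pd i (pd j (w j))) x := pd_lap (hw j) j x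
    rw [← Finset.mul_sum, Finset.sum_congr rfl fun j _ => h6 j, Finset.sum_comm,
      Finset.sum_congr rfl fun i _ => h5 i]
    simp
  simp [h4]

theorem norm_clm_sq_le_sum_sq (L : E3 →L[ℝ] ℝ) :
    ‖L‖ ^ 2 ≤ ∑ i, L (EuclideanSpace.single i 1) ^ 2 := by
  set S := ∑ i, L (EuclideanSpace.single i 1) ^ 2 with hS
  have hS0 : 0 ≤ S := Finset.sum_nonneg fun i _ => sq_nonneg _
  have h : ‖L‖ ≤ √S := by
    refine L.opNorm_le_bound (Real.sqrt_nonneg _) fun x => ?_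
    have hx : L x = ∑ i, L (EuclideanSpace.single i 1) * x i := by
      conv_lhs => rw [← (EuclideanSpace.basisFun (Fin 3) ℝ).sum_repr x]
      simp [mul_comm]
    rw [hx, Real.norm_eq_abs, EuclideanSpace.norm_eq, ← Real.sqrt_mul hS0]
    refine Real.abs_le_sqrt ?_
    simpa using Finset.sum_mul_sq_le_sq_mul_sq Finset.univ
      (fun i => L (EuclideanSpace.single i 1)) (fun i => x i)
  calc ‖L‖ ^ 2 ≤ √S ^ 2 := by gcongr
    _ = S := Real.sq_sqrt hS0

theorem exists_sobolev_const : ∃ C : ℝ, 0 < C ∧ ∀ φ : E3 → ℝ, ContDiff ℝ 1 φ →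
    HasCompactSupport φ →
    (∫ x, ‖φ x‖ ^ (6 : ℝ)) ^ ((1 : ℝ) / 3) ≤ C * ∫ x, ∑ i, pd i φ x ^ 2 := by
  set C₀ : NNReal := eLpNormLESNormFDerivOfEqInnerConst (volume : Measure E3) 2
  refine ⟨(C₀ : ℝ) ^ 2 + 1, by positivity, fun φ hφ hc => ?_⟩
  have hcf := hφ.continuous_fderiv one_ne_zero
  have h := eLpNorm_le_eLpNorm_fderiv_of_eq_inner (volume : Measure E3) hφ hc
    (p := 2) (p' := 6) (by norm_num) (by simp) (by norm_num)
  have hm1 : MemLp φ ((6 : NNReal) : ENNReal) := hφ.continuous.memLp_of_hasCompactSupport hc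
  have hm2 : MemLp (fderiv ℝ φ) ((2 : NNReal) : ENNReal) :=
    hcf.memLp_of_hasCompactSupport (hc.fderiv ℝ)
  have h' : lpNorm φ ((6 : NNReal) : ENNReal) volume
      ≤ C₀ * lpNorm (fderiv ℝ φ) ((2 : NNReal) : ENNReal) volume := by
    rw [← toReal_eLpNorm hm1.1, ← toReal_eLpNorm hm2.1]
    simpa using ENNReal.toReal_mono (ENNReal.mul_ne_top (by simp) hm2.eLpNorm_ne_top) h
  rw [lpNorm_eq_integral_norm_rpow_toReal (by simp) (by simp) hm1.1,
    lpNorm_eq_integral_norm_rpow_toReal (by simp) (by simp) hm2.1] at h'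
  simp only [ENNReal.coe_toReal, NNReal.coe_ofNat] at h'
  have hA : 0 ≤ ∫ x, ‖φ x‖ ^ (6 : ℝ) := integral_nonneg fun x => by positivity
  have hB : 0 ≤ ∫ x, ‖fderiv ℝ φ x‖ ^ (2 : ℝ) := integral_nonneg fun x => by positivity
  have hle : ∫ x, ‖fderiv ℝ φ x‖ ^ (2 : ℝ) ≤ ∫ x, ∑ i, pd i φ x ^ 2 := by
    refine integral_mono ?_ ?_ fun x => ?_
    · refine (hcf.norm.rpow_const fun _ => Or.inr (by norm_num)).integrable_of_hasCompactSupport ?_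
      exact (hc.fderiv ℝ).mono fun x hx h => hx (by simp [h])
    · refine (continuous_finsetSum _ fun i _ =>
        (hφ.continuous_partialDeriv i).pow 2).integrable_of_hasCompactSupport ?_
      exact HasCompactSupport.fun_sum fun i => (hc.partialDeriv i).fun_sq
    · simpa [pd] using norm_clm_sq_le_sum_sq (fderiv ℝ φ x)
  calc (∫ x, ‖φ x‖ ^ (6 : ℝ)) ^ ((1 : ℝ) / 3)
      = ((∫ x, ‖φ x‖ ^ (6 : ℝ)) ^ ((6 : ℝ)⁻¹)) ^ 2 := by
        rw [← Real.rpow_natCast, ← Real.rpow_mul hA]; norm_num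
    _ ≤ (C₀ * (∫ x, ‖fderiv ℝ φ x‖ ^ (2 : ℝ)) ^ ((2 : ℝ)⁻¹)) ^ 2 := by gcongr
    _ = (C₀ : ℝ) ^ 2 * ∫ x, ‖fderiv ℝ φ x‖ ^ (2 : ℝ) := by
        rw [mul_pow, ← Real.rpow_natCast (_ ^ _) 2, ← Real.rpow_mul hB]; norm_num
    _ ≤ ((C₀ : ℝ) ^ 2 + 1) * ∫ x, ∑ i, pd i φ x ^ 2 := by
        gcongr
        linarith

end Calculus

/-- `∑ᵢ (v · ∂ᵢv)²`, that is `|v|² |∇|v||²`. -/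
def radialGradSq (v : E3 → E3) (x : E3) : ℝ :=
  ∑ i : Fin 3, (∑ j : Fin 3, v x j * pd i (fun y => v y j) x) ^ 2

section VectorFields

variable {v : E3 → E3}

theorem gradSq_nonneg (v : E3 → E3) (x : E3) : 0 ≤ gradSq v x :=
  Finset.sum_nonneg fun _ _ => Finset.sum_nonneg fun _ _ => sq_nonneg _

theorem ContDiff.component {n : WithTop ℕ∞} (hv : ContDiff ℝ n v) (j : Fin 3) :
    ContDiff ℝ n fun x => v x j :=
  contDiff_euclidean.1 hv j

theorem HasCompactSupport.component (hc : HasCompactSupport v) (j : Fin 3) :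
    HasCompactSupport fun x => v x j :=
  hc.mono fun x hx h => hx (by simp [h])

theorem ContDiff.continuous_gradSq (hv : ContDiff ℝ 1 v) : Continuous (gradSq v) :=
  continuous_finsetSum _ fun i _ => continuous_finsetSum _ fun j _ =>
    ((hv.component j).continuous_partialDeriv i).pow 2

theorem HasCompactSupport.gradSq (hc : HasCompactSupport v) : HasCompactSupport (gradSq v) :=
  HasCompactSupport.fun_sum fun i => HasCompactSupport.fun_sum fun j =>
    ((hc.component j).partialDeriv i).fun_sq

theorem ContDiff.continuous_radialGradSq (hv : ContDiff ℝ 1 v) : Continuous (radialGradSq v) :=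
  continuous_finsetSum _ fun i _ => (continuous_finsetSum _ fun j _ =>
    (hv.component j).continuous.mul ((hv.component j).continuous_partialDeriv i)).pow 2

theorem HasCompactSupport.radialGradSq (hc : HasCompactSupport v) :
    HasCompactSupport (radialGradSq v) :=
  HasCompactSupport.fun_sum fun i => HasCompactSupport.fun_sq <|
    HasCompactSupport.fun_sum fun j => ((hc.component j).partialDeriv i).mul_left

theorem pd_component (hv : ContDiff ℝ 1 v) (i j : Fin 3) (x : E3) :
    pd i (fun y => v y j) x = fderiv ℝ v x (EuclideanSpace.single i 1) j := by
  have h := ((EuclideanSpace.proj (𝕜 := ℝ) j).hasFDerivAt.comp x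
    (hv.differentiable one_ne_zero x).hasFDerivAt).fderiv
  exact congrArg (fun L : E3 →L[ℝ] ℝ => L (EuclideanSpace.single i 1)) h

theorem pd_norm_rpow (hv : ContDiff ℝ 1 v) {p : ℝ} (hp : 1 < p) (i : Fin 3) (x : E3) :
    pd i (fun y => ‖v y‖ ^ p) x
      = p * ‖v x‖ ^ (p - 2) * ∑ j : Fin 3, v x j * pd i (fun y => v y j) x := by
  simp only [pd_component hv]
  rw [pd, (hv.differentiable one_ne_zero).fderiv_norm_rpow hp]
  simp [PiLp.inner_apply, mul_comm]

theorem exists_sobolev_norm_rpow_const {r : ℝ} (hr : 3 ≤ r) :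
    ∃ C : ℝ, 0 < C ∧ ∀ v : E3 → E3, ContDiff ℝ 1 v → HasCompactSupport v →
      (∫ x, ‖v x‖ ^ (3 * (r + 1))) ^ ((1 : ℝ) / 3)
        ≤ C * ∫ x, ‖v x‖ ^ (r - 3) * radialGradSq v x := by
  obtain ⟨C, hC, h⟩ := exists_sobolev_const
  refine ⟨C * ((r + 1) / 2) ^ 2, by positivity, fun v hv hc => ?_⟩
  have hp : 1 < (r + 1) / 2 := by linarith
  have h1 := h (fun x => ‖v x‖ ^ ((r + 1) / 2)) (hv.norm_rpow hp)
    (hc.mono fun x hx h => hx (by simp [h, Real.zero_rpow (by linarith : (r + 1) / 2 ≠ 0)]))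
  have e1 (x : E3) : ‖‖v x‖ ^ ((r + 1) / 2)‖ ^ (6 : ℝ) = ‖v x‖ ^ (3 * (r + 1)) := by
    rw [Real.norm_of_nonneg (by positivity), ← Real.rpow_mul (norm_nonneg _)]
    ring_nf
  have e2 (x : E3) : ∑ i, pd i (fun x => ‖v x‖ ^ ((r + 1) / 2)) x ^ 2
      = ((r + 1) / 2) ^ 2 * (‖v x‖ ^ (r - 3) * radialGradSq v x) := by
    have e3 : (‖v x‖ ^ ((r + 1) / 2 - 2)) ^ 2 = ‖v x‖ ^ (r - 3) := by
      rw [← Real.rpow_mul_natCast (norm_nonneg _)]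
      congr 1
      push_cast
      ring
    simp only [pd_norm_rpow hv hp, mul_pow, e3, radialGradSq]
    rw [← mul_assoc, Finset.mul_sum]
  simp only [e1, e2, integral_const_mul] at h1
  linarith

theorem integral_norm_rpow_mul_inner_lap (hv : ContDiff ℝ (⊤ : ℕ∞) v) (hc : HasCompactSupport v)
    {r : ℝ} (hr : 3 ≤ r) :
    ∫ x, ‖v x‖ ^ (r - 1) * ∑ j : Fin 3, v x j * lap (fun y => v y j) x
      = -∫ x, (‖v x‖ ^ (r - 1) * gradSq v x + (r - 1) * (‖v x‖ ^ (r - 3) * radialGradSq v x)) := by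
  have hv1 : ContDiff ℝ 1 v := hv.of_le (by simp)
  have hp : 1 < r - 1 := by linarith
  have hn := hv1.norm_rpow hp
  have hw (j : Fin 3) : ContDiff ℝ 1 fun x => ‖v x‖ ^ (r - 1) * v x j := hn.mul (hv1.component j)
  have e1 (x : E3) : ‖v x‖ ^ (r - 1) * ∑ j : Fin 3, v x j * lap (fun y => v y j) x
      = ∑ j : Fin 3, (‖v x‖ ^ (r - 1) * v x j) * lap (fun y => v y j) x := by
    simp only [Finset.mul_sum, mul_assoc]
  have i1 (j : Fin 3) : Integrable fun x =>
      (‖v x‖ ^ (r - 1) * v x j) * lap (fun y => v y j) x :=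
    ((hw j).continuous.mul (hv.component j).laplacian.continuous).integrable_of_hasCompactSupport
      (hc.component j).laplacian.mul_left
  have i2 (j : Fin 3) : Integrable fun x =>
      ∑ i, pd i (fun y => ‖v y‖ ^ (r - 1) * v y j) x * pd i (fun y => v y j) x :=
    integrable_finsetSum _ fun i _ => (((hw j).continuous_partialDeriv i).mul
      ((hv.component j).partialDeriv i).continuous).integrable_of_hasCompactSupport
      ((hc.component j).partialDeriv i).mul_left
  simp only [e1]
  rw [integral_finsetSum _ fun j _ => i1 j, Finset.sum_congr rfl fun j _ =>
    integral_mul_lap (hw j) (hv.component j) (hc.component j), Finset.sum_neg_distrib,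
    ← integral_finsetSum _ fun j _ => i2 j]
  congr 2
  funext x
  have e2 (i j : Fin 3) : pd i (fun y => ‖v y‖ ^ (r - 1) * v y j) x
      = ‖v x‖ ^ (r - 1) * pd i (fun y => v y j) x
        + (r - 1) * ‖v x‖ ^ (r - 3) * (∑ k, v x k * pd i (fun y => v y k) x) * v x j := by
    rw [pd_mul i (hn.differentiable one_ne_zero x) ((hv1.component j).differentiable one_ne_zero x),
      pd_norm_rpow hv1 hp]
    ring_nf
  simp only [e2, gradSq, radialGradSq, Fin.sum_univ_three]
  ring

theorem integral_inner_lap {w u : E3 → E3} (hw : ContDiff ℝ 1 w) (hu : ContDiff ℝ (⊤ : ℕ∞) u)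
    (hc : HasCompactSupport u) :
    ∫ x, ∑ j : Fin 3, w x j * lap (fun y => u y j) x
      = -∫ x, ∑ i : Fin 3, ∑ j : Fin 3, pd i (fun y => w y j) x * pd i (fun y => u y j) x := by
  have i1 (j : Fin 3) : Integrable fun x => w x j * lap (fun y => u y j) x :=
    ((hw.component j).continuous.mul
      (hu.component j).laplacian.continuous).integrable_of_hasCompactSupport
      (hc.component j).laplacian.mul_left
  have i2 (j : Fin 3) : Integrable fun x =>
      ∑ i, pd i (fun y => w y j) x * pd i (fun y => u y j) x :=
    integrable_finsetSum _ fun i _ => (((hw.component j).continuous_partialDeriv i).mul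
      ((hu.component j).partialDeriv i).continuous).integrable_of_hasCompactSupport
      ((hc.component j).partialDeriv i).mul_left
  rw [integral_finsetSum _ fun j _ => i1 j, Finset.sum_congr rfl fun j _ =>
    integral_mul_lap (hw.component j) (hu.component j) (hc.component j), Finset.sum_neg_distrib,
    ← integral_finsetSum _ fun j _ => i2 j]
  congr 2
  funext x
  exact Finset.sum_comm

end VectorFields

section TimeDerivative

theorem pd_comp_prodMk {h : ℝ × E3 → ℝ} {s : ℝ} {x : E3} (hh : DifferentiableAt ℝ h (s, x))
    (i : Fin 3) :
    pd i (fun y => h (s, y)) x = fderiv ℝ h (s, x) (0, EuclideanSpace.single i 1) := by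
  have h1 := (hh.hasFDerivAt.comp x (hasFDerivAt_prodMk_right (𝕜 := ℝ) s x)).fderiv
  exact congrArg (fun L : E3 →L[ℝ] ℝ => L (EuclideanSpace.single i 1)) h1

theorem hasDerivAt_comp_prodMk {h : ℝ × E3 → ℝ} {s : ℝ} {x : E3}
    (hh : DifferentiableAt ℝ h (s, x)) :
    HasDerivAt (fun τ => h (τ, x)) (fderiv ℝ h (s, x) (1, 0)) s := by
  simpa [Function.comp_def] using
    (hh.hasFDerivAt.comp s (hasFDerivAt_prodMk_left (𝕜 := ℝ) s x)).hasDerivAt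

theorem hasDerivAt_integral_of_support_subset {H : ℝ × E3 → ℝ} (hH : ContDiff ℝ 1 H) {t : ℝ}
    {K : Set E3} (hK : IsCompact K)
    (h0 : ∀ s ∈ Set.Icc (t - 1) (t + 1), ∀ x ∉ K, H (s, x) = 0) :
    HasDerivAt (fun s => ∫ x, H (s, x)) (∫ x, fderiv ℝ H (t, x) (1, 0)) t := by
  have hd (s : ℝ) (x : E3) := hasDerivAt_comp_prodMk (hH.differentiable one_ne_zero (s, x))
  have hcont : Continuous fun q => fderiv ℝ H q (1, 0) :=
    (hH.continuous_fderiv one_ne_zero).clm_apply continuous_const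
  obtain ⟨M, hM⟩ := (isCompact_Icc (a := t - 1) (b := t + 1)).prod hK
    |>.exists_bound_of_continuousOn hcont.continuousOn
  have hd0 : ∀ s ∈ Set.Ioo (t - 1) (t + 1), ∀ x ∉ K, fderiv ℝ H (s, x) (1, 0) = 0 := by
    intro s hs x hx
    refine (hd s x).unique ((hasDerivAt_const s (0 : ℝ)).congr_of_eventuallyEq ?_)
    filter_upwards [Ioo_mem_nhds hs.1 hs.2] with τ hτ
    exact h0 τ (Set.Ioo_subset_Icc_self hτ) x hx
  have ht : t ∈ Set.Icc (t - 1) (t + 1) := ⟨by linarith, by linarith⟩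
  refine (hasDerivAt_integral_of_dominated_loc_of_deriv_le
    (F := fun s x => H (s, x)) (F' := fun s x => fderiv ℝ H (s, x) (1, 0))
    (bound := K.indicator fun _ => M) (s := Set.Ioo (t - 1) (t + 1))
    (Ioo_mem_nhds (by linarith) (by linarith)) (.of_forall fun s => ?_) ?_ ?_
    (.of_forall fun x s hs => ?_) ?_ (.of_forall fun x s _ => hd s x)).2
  · exact (hH.continuous.comp (by fun_prop)).aestronglyMeasurable
  · exact (hH.continuous.comp (by fun_prop : Continuous fun x : E3 => (t, x)))
      |>.integrable_of_hasCompactSupport (HasCompactSupport.intro hK fun x hx => h0 t ht x hx)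
  · exact (hcont.comp (by fun_prop : Continuous fun x : E3 => (t, x))).aestronglyMeasurable
  · by_cases hx : x ∈ K
    · simpa [hx] using hM (s, x) ⟨Set.Ioo_subset_Icc_self hs, hx⟩
    · simp [hx, hd0 s hs x hx]
  · exact (integrable_indicator_iff hK.measurableSet).2 (integrableOn_const hK.measure_lt_top.ne)

theorem gradSq_eq_zero_of_notMem {v : E3 → E3} {K : Set E3} (hK : IsClosed K)
    (hv : ∀ x ∉ K, v x = 0) {x : E3} (hx : x ∉ K) : gradSq v x = 0 := by
  have h (i j : Fin 3) : pd i (fun y => v y j) x = 0 := by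
    have he : (fun y => v y j) =ᶠ[nhds x] fun _ => 0 := by
      filter_upwards [hK.isOpen_compl.mem_nhds hx] with y hy
      simp [hv y hy]
    simp [pd, he.fderiv_eq]
  simp [gradSq, h]

theorem hasDerivAt_integral_gradSq {u : ℝ → E3 → E3}
    (hu : ContDiff ℝ (⊤ : ℕ∞) fun q : ℝ × E3 => u q.1 q.2) {t : ℝ} {K : Set E3}
    (hK : IsCompact K) (h0 : ∀ s ∈ Set.Icc (t - 1) (t + 1), ∀ x ∉ K, u s x = 0) :
    HasDerivAt (fun s => ∫ x, gradSq (u s) x)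
      (2 * ∫ x, ∑ i : Fin 3, ∑ j : Fin 3,
        pd i (fun y => deriv (fun s => u s y j) t) x * pd i (fun y => u t y j) x) t := by
  have hU (j : Fin 3) : ContDiff ℝ (⊤ : ℕ∞) fun q : ℝ × E3 => u q.1 q.2 j :=
    contDiff_euclidean.1 hu j
  have hD (j : Fin 3) (a : ℝ × E3) :
      ContDiff ℝ (⊤ : ℕ∞) fun q : ℝ × E3 => fderiv ℝ (fun q : ℝ × E3 => u q.1 q.2 j) q a :=
    ((hU j).fderiv_right (m := (⊤ : ℕ∞)) (by simp)).clm_apply contDiff_const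
  have e1 (s : ℝ) (x : E3) (i j : Fin 3) : pd i (fun y => u s y j) x
      = fderiv ℝ (fun q : ℝ × E3 => u q.1 q.2 j) (s, x) (0, EuclideanSpace.single i 1) :=
    pd_comp_prodMk (h := fun q : ℝ × E3 => u q.1 q.2 j) ((hU j).differentiable (by simp) (s, x)) i
  have e2 (s : ℝ) (x : E3) (j : Fin 3) : deriv (fun s => u s x j) s
      = fderiv ℝ (fun q : ℝ × E3 => u q.1 q.2 j) (s, x) (1, 0) :=
    (hasDerivAt_comp_prodMk (h := fun q : ℝ × E3 => u q.1 q.2 j)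
      ((hU j).differentiable (by simp) (s, x))).deriv
  have hH : ContDiff ℝ (⊤ : ℕ∞) fun q : ℝ × E3 => gradSq (u q.1) q.2 := by
    simp only [gradSq, e1]
    exact ContDiff.sum fun i _ => ContDiff.sum fun j _ => (hD j _).pow 2
  have e3 (x : E3) : fderiv ℝ (fun q : ℝ × E3 => gradSq (u q.1) q.2) (t, x) (1, 0)
      = 2 * ∑ i : Fin 3, ∑ j : Fin 3,
        pd i (fun y => deriv (fun s => u s y j) t) x * pd i (fun y => u t y j) x := by
    refine (hasDerivAt_comp_prodMk (hH.differentiable (by simp) (t, x))).unique ?_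
    simp only [gradSq, Finset.mul_sum]
    refine HasDerivAt.fun_sum fun i _ => HasDerivAt.fun_sum fun j _ => ?_
    simp only [e1, e2]
    have h1 := (hasDerivAt_comp_prodMk ((hD j (0, EuclideanSpace.single i 1)).differentiable
      (by simp) (t, x))).pow 2
    rw [fderiv_fderiv_apply_comm (hU j), ← pd_comp_prodMk
      ((hD j (1, 0)).differentiable (by simp) (t, x)) i] at h1
    refine h1.congr_deriv ?_
    simp
    ring
  rw [← integral_const_mul]
  simp only [← e3]
  exact hasDerivAt_integral_of_support_subset (hH.of_le (by simp)) hK fun s hs x hx =>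
    gradSq_eq_zero_of_notMem hK.isClosed (h0 s hs) hx

theorem contDiff_deriv_time {u : ℝ → E3 → E3}
    (hu : ContDiff ℝ (⊤ : ℕ∞) fun q : ℝ × E3 => u q.1 q.2) (t : ℝ) (j : Fin 3) :
    ContDiff ℝ (⊤ : ℕ∞) fun x => deriv (fun s => u s x j) t := by
  have hU : ContDiff ℝ (⊤ : ℕ∞) fun q : ℝ × E3 => u q.1 q.2 j := contDiff_euclidean.1 hu j
  have e (x : E3) : deriv (fun s => u s x j) t
      = fderiv ℝ (fun q : ℝ × E3 => u q.1 q.2 j) (t, x) (1, 0) :=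
    (hasDerivAt_comp_prodMk (h := fun q : ℝ × E3 => u q.1 q.2 j)
      (hU.differentiable (by simp) (t, x))).deriv
  simp only [e]
  exact ((hU.fderiv_right (m := (⊤ : ℕ∞)) (by simp)).clm_apply contDiff_const).comp
    (contDiff_const.prodMk contDiff_id)

end TimeDerivative

section PointwiseEstimates

theorem exists_sq_le_rpow_add_const {μ β r : ℝ} (hμ : 0 < μ) (hβ : 0 < β) (hr : 3 ≤ r)
    (hr3 : r = 3 → 1 ≤ 2 * β * μ) :
    ∃ K : ℝ, 0 ≤ K ∧ ∀ s : ℝ, 0 ≤ s → 1 / (2 * μ) * s ^ 2 ≤ β * s ^ (r - 1) + K := by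
  rcases hr.eq_or_lt with rfl | hr
  · refine ⟨0, le_rfl, fun s hs => ?_⟩
    have h1 : 1 / (2 * μ) ≤ β := by
      rw [div_le_iff₀ (by positivity)]
      linarith [hr3 rfl]
    have h2 : s ^ ((3 : ℝ) - 1) = s ^ 2 := by
      rw [← Real.rpow_natCast]
      norm_num
    rw [h2, add_zero]
    gcongr
  · set s₀ := (1 / (2 * μ * β)) ^ (1 / (r - 3)) with hs₀
    have hpos : 0 < s₀ := by positivity
    have hs₀r : β * s₀ ^ (r - 3) = 1 / (2 * μ) := by
      rw [hs₀, ← Real.rpow_mul (by positivity), one_div_mul_cancel (by linarith), Real.rpow_one]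
      field_simp
    refine ⟨1 / (2 * μ) * s₀ ^ 2, by positivity, fun s hs => ?_⟩
    rcases le_total s s₀ with h | h
    · have h1 : 0 ≤ β * s ^ (r - 1) := by positivity
      have h2 : 1 / (2 * μ) * s ^ 2 ≤ 1 / (2 * μ) * s₀ ^ 2 := by gcongr
      linarith
    · have h1 : s ^ (r - 1) = s ^ (r - 3) * s ^ 2 := by
        rw [← Real.rpow_natCast s 2, ← Real.rpow_add (hpos.trans_le h)]
        congr 1
        push_cast
        ring
      have h2 : s₀ ^ (r - 3) ≤ s ^ (r - 3) := Real.rpow_le_rpow hpos.le h (by linarith)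
      have h3 : 1 / (2 * μ) * s ^ 2 ≤ β * s ^ (r - 1) := by
        rw [h1, ← hs₀r, mul_assoc]
        gcongr
      have h4 : 0 ≤ 1 / (2 * μ) * s₀ ^ 2 := by positivity
      linarith

theorem rpow_mul_le_rpow_add_rpow {a b r : ℝ} (ha : 0 ≤ a) (hb : 0 ≤ b) (hr : 0 < r) :
    a ^ r * b ≤ a ^ (r + 1) + b ^ (r + 1) := by
  have h1 (c : ℝ) (hc : 0 ≤ c) : c ^ (r + 1) = c ^ r * c := Real.rpow_add_one' hc (by linarith)
  have h2 : 0 ≤ a ^ r * a := by positivity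
  have h3 : 0 ≤ b ^ r * b := by positivity
  rw [h1 a ha, h1 b hb]
  rcases le_total a b with h | h
  · have : a ^ r * b ≤ b ^ r * b := by gcongr
    linarith
  · have : a ^ r * b ≤ a ^ r * a := by gcongr
    linarith

theorem convection_forcing_le {μ : ℝ} (hμ : 0 < μ) (v L F : E3) (A : Fin 3 → Fin 3 → ℝ) :
    -(μ * ∑ j, L j ^ 2) + (∑ j, (∑ i, v i * A i j) * L j) - ∑ j, F j * L j
      ≤ 1 / (2 * μ) * (‖v‖ ^ 2 * ∑ i, ∑ j, A i j ^ 2) + 1 / (2 * μ) * ‖F‖ ^ 2 := by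
  have young (a b : ℝ) : a * b ≤ μ / 2 * b ^ 2 + 1 / (2 * μ) * a ^ 2 := by
    have h : μ / 2 * b ^ 2 + 1 / (2 * μ) * a ^ 2 - a * b = 1 / (2 * μ) * (a - μ * b) ^ 2 := by
      field_simp
      ring
    have : 0 ≤ 1 / (2 * μ) * (a - μ * b) ^ 2 := by positivity
    linarith
  have h1 : ∑ j, (∑ i, v i * A i j) * L j
      ≤ μ / 2 * ∑ j, L j ^ 2 + 1 / (2 * μ) * (‖v‖ ^ 2 * ∑ i, ∑ j, A i j ^ 2) := by
    rw [Finset.sum_comm (f := fun i j => A i j ^ 2), Finset.mul_sum, Finset.mul_sum,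
      Finset.mul_sum, ← Finset.sum_add_distrib]
    refine Finset.sum_le_sum fun j _ => (young _ _).trans ?_
    rw [EuclideanSpace.real_norm_sq_eq]
    gcongr
    exact Finset.sum_mul_sq_le_sq_mul_sq _ _ _
  have h2 : ∑ j, -F j * L j ≤ μ / 2 * ∑ j, L j ^ 2 + 1 / (2 * μ) * ‖F‖ ^ 2 := by
    rw [EuclideanSpace.real_norm_sq_eq, Finset.mul_sum, Finset.mul_sum, ← Finset.sum_add_distrib]
    refine Finset.sum_le_sum fun j _ => ?_
    simpa using young (-F j) (L j)
  simp only [neg_mul, Finset.sum_neg_distrib] at h2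
  linarith

theorem damping_noise_le {r : ℝ} (hr : 3 ≤ r) (y : ℝ) (v b : E3) :
    -(‖v‖ ^ (r - 1) * (y * ∑ j, v j * b j))
      ≤ ‖v‖ ^ (r + 1) + |y| ^ (r + 1) * ‖b‖ ^ (r + 1) := by
  have h1 : ∑ j, v j * b j = inner ℝ v b := by simp [PiLp.inner_apply, mul_comm]
  calc -(‖v‖ ^ (r - 1) * (y * ∑ j, v j * b j))
      ≤ |‖v‖ ^ (r - 1) * (y * ∑ j, v j * b j)| := neg_le_abs _
    _ = ‖v‖ ^ (r - 1) * (|y| * |inner ℝ v b|) := by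
        rw [h1, abs_mul, abs_mul, abs_of_nonneg (by positivity : 0 ≤ ‖v‖ ^ (r - 1))]
    _ ≤ ‖v‖ ^ (r - 1) * (|y| * (‖v‖ * ‖b‖)) := by
        gcongr
        exact abs_real_inner_le_norm v b
    _ = ‖v‖ ^ r * (|y| * ‖b‖) := by
        have : ‖v‖ ^ r = ‖v‖ ^ (r - 1) * ‖v‖ := by
          rw [← Real.rpow_add_one' (norm_nonneg v) (by linarith)]
          ring_nf
        rw [this]
        ring
    _ ≤ ‖v‖ ^ (r + 1) + (|y| * ‖b‖) ^ (r + 1) :=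
        rpow_mul_le_rpow_add_rpow (norm_nonneg _) (by positivity) (by linarith)
    _ = ‖v‖ ^ (r + 1) + |y| ^ (r + 1) * ‖b‖ ^ (r + 1) := by
        rw [Real.mul_rpow (abs_nonneg _) (norm_nonneg _)]

theorem norm_add_three_sq_le (a b c : E3) :
    ‖a + b + c‖ ^ 2 ≤ 3 * (‖a‖ ^ 2 + ‖b‖ ^ 2 + ‖c‖ ^ 2) := by
  have h : ‖a + b + c‖ ≤ ‖a‖ + ‖b‖ + ‖c‖ := norm_add₃_le
  calc ‖a + b + c‖ ^ 2 ≤ (‖a‖ + ‖b‖ + ‖c‖) ^ 2 := by gcongr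
    _ ≤ 3 * (‖a‖ ^ 2 + ‖b‖ ^ 2 + ‖c‖ ^ 2) := by
      nlinarith [sq_nonneg (‖a‖ - ‖b‖), sq_nonneg (‖a‖ - ‖c‖), sq_nonneg (‖b‖ - ‖c‖)]

end PointwiseEstimates

/-- The componentwise Laplacian of a vector field on ℝ³. -/
def vecLap (v : E3 → E3) (x : E3) : E3 :=
  WithLp.toLp 2 fun j => lap (fun y => v y j) x

section EnergyEstimate

theorem HasCompactSupport.add_const_smul {u g : E3 → E3} (hu : HasCompactSupport u)
    (hg : HasCompactSupport g) (y : ℝ) : HasCompactSupport fun x => u x + y • g x := by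
  have h : HasCompactSupport fun x => y • g x := hg.mono fun x hx h => hx (by simp [h])
  exact hu.add h

theorem ContDiff.continuous_vecLap {v : E3 → E3} (hv : ContDiff ℝ (⊤ : ℕ∞) v) :
    Continuous (vecLap v) :=
  (PiLp.continuous_toLp 2 _).comp
    (continuous_pi fun j => (hv.component j).laplacian.continuous)

theorem HasCompactSupport.vecLap {v : E3 → E3} (hc : HasCompactSupport v) :
    HasCompactSupport (vecLap v) := by
  have h : HasCompactSupport fun x => ∑ j, lap (fun y => v y j) x ^ 2 :=
    HasCompactSupport.fun_sum fun j => (hc.component j).laplacian.fun_sq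
  refine h.mono fun x hx h0 => hx ?_
  ext j
  have h1 := (Finset.sum_eq_zero_iff_of_nonneg fun i _ => sq_nonneg _).1 h0 j (Finset.mem_univ j)
  simpa [_root_.vecLap] using h1

theorem gradSq_add_smul_le {u g : E3 → E3} (hu : ContDiff ℝ 1 u) (hg : ContDiff ℝ 1 g) (y : ℝ)
    (x : E3) : gradSq (fun x => u x + y • g x) x ≤ 2 * gradSq u x + 2 * y ^ 2 * gradSq g x := by
  simp only [gradSq, Finset.mul_sum, ← Finset.sum_add_distrib]
  refine Finset.sum_le_sum fun i _ => Finset.sum_le_sum fun j _ => ?_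
  have h : pd i (fun x => (u x + y • g x) j) x
      = pd i (fun x => u x j) x + pd i (fun x => g x j) x * y := by
    rw [← pd_mul_const i y ((hg.component j).differentiable one_ne_zero x),
      ← pd_add i ((hu.component j).differentiable one_ne_zero x)
        (((hg.component j).differentiable one_ne_zero x).mul_const y)]
    simp [mul_comm]
  rw [h]
  nlinarith [sq_nonneg (pd i (fun x => u x j) x - pd i (fun x => g x j) x * y)]

/-- The equation tested with `-Δu`, estimated pointwise. -/
theorem energy_integrand_le {μ α β σ r K : ℝ} (hμ : 0 < μ) (hβ : 0 < β)
    (hr : 3 ≤ r) (hK0 : 0 ≤ K)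
    (hK : ∀ s : ℝ, 0 ≤ s → 1 / (2 * μ) * s ^ 2 ≤ β * s ^ (r - 1) + K)
    {g u v w f : E3 → E3} {p : E3 → ℝ} (y : ℝ)
    (hg : ContDiff ℝ (⊤ : ℕ∞) g) (hu : ContDiff ℝ (⊤ : ℕ∞) u)
    (hv_def : v = fun x => u x + y • g x) (x : E3)
    (heq : ∀ j : Fin 3, w x j - μ * lap (fun z => u z j) x
      + (∑ i : Fin 3, (u x i + g x i * y) * pd i (fun z => u z j + g z j * y) x)
      + α * u x j + β * ‖u x + y • g x‖ ^ (r - 1) * (u x j + g x j * y)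
      = -(pd j p x) + f x j + (σ - α) * (g x j * y) + μ * y * lap (fun z => g z j) x) :
    -(∑ j : Fin 3, w x j * lap (fun z => u z j) x)
      - α * (∑ j : Fin 3, u x j * lap (fun z => u z j) x)
      - β * (‖v x‖ ^ (r - 1) * ∑ j : Fin 3, v x j * lap (fun z => v z j) x)
      - (∑ j : Fin 3, pd j p x * lap (fun z => u z j) x)
    ≤ β * (‖v x‖ ^ (r - 1) * gradSq v x)
      + (2 * K * gradSq u x + 2 * K * y ^ 2 * gradSq g x
        + β * ‖v x‖ ^ (r + 1) + β * |y| ^ (r + 1) * ‖vecLap g x‖ ^ (r + 1)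
        + 3 / (2 * μ) * (‖f x‖ ^ 2 + (σ - α) ^ 2 * y ^ 2 * ‖g x‖ ^ 2
          + μ ^ 2 * y ^ 2 * ‖vecLap g x‖ ^ 2)) := by
  have hvx (x : E3) : u x + y • g x = v x := by rw [hv_def]
  have hvj (x : E3) (j : Fin 3) : u x j + g x j * y = v x j := by simp [hv_def, mul_comm]
  have hlapv (x : E3) (j : Fin 3) : lap (fun z => v z j) x
      = lap (fun z => u z j) x + y * lap (fun z => g z j) x := by
    simp only [← hvj]
    rw [lap_add (hu.component j) ((hg.component j).mul contDiff_const),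
      lap_mul_const (hg.component j), mul_comm y]
  set F : E3 := f x + ((σ - α) * y) • g x + (μ * y) • vecLap g x with hF
  have hFj (j : Fin 3) : F j
      = f x j + (σ - α) * y * g x j + μ * y * lap (fun z => g z j) x := by
    simp [hF, vecLap]
  have hx := heq
  simp only [hvj, hvx] at hx
  have h1 := convection_forcing_le hμ (v x) (vecLap u x) F fun i j => pd i (fun z => v z j) x
  have h2 := damping_noise_le hr y (v x) (vecLap g x)
  have h3 : ‖F‖ ^ 2 ≤ 3 * (‖f x‖ ^ 2 + (σ - α) ^ 2 * y ^ 2 * ‖g x‖ ^ 2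
      + μ ^ 2 * y ^ 2 * ‖vecLap g x‖ ^ 2) := by
    refine (norm_add_three_sq_le _ _ _).trans_eq ?_
    simp only [norm_smul, mul_pow, Real.norm_eq_abs, sq_abs]
  have h4 : 1 / (2 * μ) * ‖F‖ ^ 2 ≤ 3 / (2 * μ) * (‖f x‖ ^ 2 + (σ - α) ^ 2 * y ^ 2 * ‖g x‖ ^ 2
      + μ ^ 2 * y ^ 2 * ‖vecLap g x‖ ^ 2) :=
    (mul_le_mul_of_nonneg_left h3 (by positivity)).trans_eq (by ring)
  have h5 : 1 / (2 * μ) * (‖v x‖ ^ 2 * gradSq v x)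
      ≤ β * (‖v x‖ ^ (r - 1) * gradSq v x) + K * gradSq v x := by
    have := mul_le_mul_of_nonneg_right (hK ‖v x‖ (norm_nonneg _)) (gradSq_nonneg v x)
    linarith
  have h6 : K * gradSq v x ≤ K * (2 * gradSq u x + 2 * y ^ 2 * gradSq g x) :=
    mul_le_mul_of_nonneg_left (by
      rw [hv_def]
      exact gradSq_add_smul_le (hu.of_le (by simp)) (hg.of_le (by simp)) y x) hK0
  have h7 := mul_le_mul_of_nonneg_left h2 hβ.le
  have h8 : -(∑ j : Fin 3, w x j * lap (fun z => u z j) x)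
      - α * (∑ j : Fin 3, u x j * lap (fun z => u z j) x)
      - β * (‖v x‖ ^ (r - 1) * ∑ j : Fin 3, v x j * lap (fun z => v z j) x)
      - (∑ j : Fin 3, pd j p x * lap (fun z => u z j) x)
      = (-(μ * ∑ j, vecLap u x j ^ 2)
          + (∑ j, (∑ i, v x i * pd i (fun z => v z j) x) * vecLap u x j)
          - ∑ j, F j * vecLap u x j)
        + β * -(‖v x‖ ^ (r - 1) * (y * ∑ j, v x j * vecLap g x j)) := by
    simp only [hlapv, hFj, vecLap, Finset.mul_sum, ← Finset.sum_neg_distrib,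
      ← Finset.sum_add_distrib, ← Finset.sum_sub_distrib]
    refine Finset.sum_congr rfl fun j _ => ?_
    linear_combination (-lap (fun z => u z j) x) * hx j
  have h9 : gradSq v x = ∑ i, ∑ j, pd i (fun z => v z j) x ^ 2 := rfl
  rw [← h9] at h1
  rw [h8]
  linarith

theorem gradient_energy_estimate {μ α β σ r K : ℝ} (hμ : 0 < μ) (hβ : 0 < β)
    (hr : 3 ≤ r) (hK0 : 0 ≤ K)
    (hK : ∀ s : ℝ, 0 ≤ s → 1 / (2 * μ) * s ^ 2 ≤ β * s ^ (r - 1) + K)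
    {g u w f : E3 → E3} {p : E3 → ℝ} (y : ℝ)
    (hg : ContDiff ℝ (⊤ : ℕ∞) g) (hgc : HasCompactSupport g)
    (hu : ContDiff ℝ (⊤ : ℕ∞) u) (huc : HasCompactSupport u)
    (hudiv : ∀ x, ∑ j : Fin 3, pd j (fun z => u z j) x = 0)
    (hw : ContDiff ℝ 1 w) (hfi : Integrable fun x => ‖f x‖ ^ 2)
    (hp : ContDiff ℝ 1 p)
    (heq : ∀ x (j : Fin 3), w x j - μ * lap (fun z => u z j) x
      + (∑ i : Fin 3, (u x i + g x i * y) * pd i (fun z => u z j + g z j * y) x)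
      + α * u x j + β * ‖u x + y • g x‖ ^ (r - 1) * (u x j + g x j * y)
      = -(pd j p x) + f x j + (σ - α) * (g x j * y) + μ * y * lap (fun z => g z j) x) :
    (∫ x, ∑ i : Fin 3, ∑ j : Fin 3, pd i (fun z => w z j) x * pd i (fun z => u z j) x)
      + α * (∫ x, gradSq u x)
      + β * (r - 1) * (∫ x, ‖u x + y • g x‖ ^ (r - 3) * radialGradSq (fun x => u x + y • g x) x)
      ≤ 2 * K * (∫ x, gradSq u x) + 2 * K * y ^ 2 * (∫ x, gradSq g x)
        + β * (∫ x, ‖u x + y • g x‖ ^ (r + 1))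
        + β * |y| ^ (r + 1) * (∫ x, ‖vecLap g x‖ ^ (r + 1))
        + 3 / (2 * μ) * ((∫ x, ‖f x‖ ^ 2) + (σ - α) ^ 2 * y ^ 2 * (∫ x, ‖g x‖ ^ 2)
          + μ ^ 2 * y ^ 2 * (∫ x, ‖vecLap g x‖ ^ 2)) := by
  set v : E3 → E3 := fun x => u x + y • g x with hv_def
  have hv : ContDiff ℝ (⊤ : ℕ∞) v := hu.add (hg.const_smul y)
  have hvc : HasCompactSupport v := huc.add_const_smul hgc y
  have hu1 : ContDiff ℝ 1 u := hu.of_le (by simp)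
  have hg1 : ContDiff ℝ 1 g := hg.of_le (by simp)
  have hv1 : ContDiff ℝ 1 v := hv.of_le (by simp)
  have cpow (a : ℝ) (ha : 0 ≤ a) {V : E3 → E3} (hV : Continuous V) :
      Continuous fun x => ‖V x‖ ^ a := hV.norm.rpow_const fun _ => Or.inr ha
  have spow (a : ℝ) (ha : 0 < a) {V : E3 → E3} (hV : HasCompactSupport V) :
      HasCompactSupport fun x => ‖V x‖ ^ a :=
    hV.mono fun x hx h => hx (by simp [h, Real.zero_rpow ha.ne'])
  have ssq {V : E3 → E3} (hV : HasCompactSupport V) : HasCompactSupport fun x => ‖V x‖ ^ 2 :=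
    hV.mono fun x hx h => hx (by simp [h])
  have iw : Integrable fun x => ∑ j : Fin 3, w x j * lap (fun z => u z j) x :=
    integrable_finsetSum _ fun j _ => ((hw.component j).continuous.mul
      (hu.component j).laplacian.continuous).integrable_of_hasCompactSupport
      (huc.component j).laplacian.mul_left
  have iu : Integrable fun x => ∑ j : Fin 3, u x j * lap (fun z => u z j) x :=
    integrable_finsetSum _ fun j _ => ((hu.component j).continuous.mul
      (hu.component j).laplacian.continuous).integrable_of_hasCompactSupport
      (huc.component j).laplacian.mul_left
  have ip : Integrable fun x => ∑ j : Fin 3, pd j p x * lap (fun z => u z j) x :=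
    integrable_finsetSum _ fun j _ => ((hp.continuous_partialDeriv j).mul
      (hu.component j).laplacian.continuous).integrable_of_hasCompactSupport
      (huc.component j).laplacian.mul_left
  have iv : Integrable fun x =>
      ‖v x‖ ^ (r - 1) * ∑ j : Fin 3, v x j * lap (fun z => v z j) x :=
    ((cpow _ (by linarith) hv.continuous).mul (continuous_finsetSum _ fun j _ =>
      (hv.component j).continuous.mul
        (hv.component j).laplacian.continuous)).integrable_of_hasCompactSupport
      (spow _ (by linarith) hvc).mul_right
  have iD : Integrable fun x => ‖v x‖ ^ (r - 1) * gradSq v x :=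
    ((cpow _ (by linarith) hv.continuous).mul
      hv1.continuous_gradSq).integrable_of_hasCompactSupport hvc.gradSq.mul_left
  have iQ : Integrable fun x => ‖v x‖ ^ (r - 3) * radialGradSq v x :=
    ((cpow _ (by linarith) hv.continuous).mul
      hv1.continuous_radialGradSq).integrable_of_hasCompactSupport hvc.radialGradSq.mul_left
  have iGu : Integrable (gradSq u) :=
    hu1.continuous_gradSq.integrable_of_hasCompactSupport huc.gradSq
  have iGg : Integrable (gradSq g) :=
    hg1.continuous_gradSq.integrable_of_hasCompactSupport hgc.gradSq
  have iV : Integrable fun x => ‖v x‖ ^ (r + 1) :=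
    (cpow _ (by linarith) hv.continuous).integrable_of_hasCompactSupport
      (spow _ (by linarith) hvc)
  have iL : Integrable fun x => ‖vecLap g x‖ ^ (r + 1) :=
    (cpow _ (by linarith) hg.continuous_vecLap).integrable_of_hasCompactSupport
      (spow _ (by linarith) hgc.vecLap)
  have iL2 : Integrable fun x => ‖vecLap g x‖ ^ 2 :=
    (hg.continuous_vecLap.norm.pow 2).integrable_of_hasCompactSupport (ssq hgc.vecLap)
  have ig2 : Integrable fun x => ‖g x‖ ^ 2 :=
    (hg.continuous.norm.pow 2).integrable_of_hasCompactSupport (ssq hgc)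
  have hpt := fun x => energy_integrand_le hμ hβ hr hK0 hK y hg hu hv_def x (heq x)
  have i1 := iw.fun_neg
  have i2 := i1.sub' (iu.const_mul α)
  have i3 := i2.sub' (iv.const_mul β)
  have j1 := (iGu.const_mul (2 * K)).fun_add (iGg.const_mul (2 * K * y ^ 2))
  have j2 := j1.fun_add (iV.const_mul β)
  have j3 := j2.fun_add (iL.const_mul (β * |y| ^ (r + 1)))
  have k1 := hfi.fun_add (ig2.const_mul ((σ - α) ^ 2 * y ^ 2))
  have k2 := (k1.fun_add (iL2.const_mul (μ ^ 2 * y ^ 2))).const_mul (3 / (2 * μ))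
  have hint := integral_mono (i3.sub' ip) ((iD.const_mul β).fun_add (j3.fun_add k2)) hpt
  rw [integral_sub i3 ip, integral_sub i2 (iv.const_mul β), integral_sub i1 (iu.const_mul α),
    integral_neg, integral_add (iD.const_mul β) (j3.fun_add k2), integral_add j3 k2,
    integral_add j2 (iL.const_mul _), integral_add j1 (iV.const_mul _),
    integral_add (iGu.const_mul _) (iGg.const_mul _), integral_const_mul (3 / (2 * μ)),
    integral_add k1 (iL2.const_mul _), integral_add hfi (ig2.const_mul _)] at hint
  simp only [integral_const_mul] at hint
  rw [integral_inner_lap hw hu huc, integral_inner_lap hu1 hu huc,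
    integral_norm_rpow_mul_inner_lap hv hvc hr,
    integral_grad_inner_lap_eq_zero hp hu.component huc.component hudiv,
    integral_add iD (iQ.const_mul (r - 1)), integral_const_mul] at hint
  have hG : ∫ x, ∑ i : Fin 3, ∑ j : Fin 3, pd i (fun z => u z j) x * pd i (fun z => u z j) x
      = ∫ x, gradSq u x := by simp only [gradSq, sq]
  rw [hG] at hint
  linarith

end EnergyEstimate

/-- Second (gradient) energy inequality (4.5) of Lemma 4.1, for classical spatially
compactly supported solutions of the transformed 3D stochastic CBF equations with
additive noise (`r ≥ 3`, and `2βμ ≥ 1` if `r = 3`):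
`G′(t) + αG(t) + (C*/2)‖u + g y(t)‖_{L^{3(r+1)}}^{r+1}
  ≤ R̃ (∫|f|² + ∫|u|² + ∫|∇u|² + ∫|u + g y(t)|^{r+1} + |y(t)|² + |y(t)|^{r+1})`,
where `G(t) = ∫|∇u(t)|² dx`. -/
theorem stmt17 (μ α β σ r : ℝ) (hμ : 0 < μ) (hα : 0 < α) (hβ : 0 < β) (hσ : 0 < σ)
    (hr : 3 ≤ r) (hr3 : r = 3 → 1 ≤ 2 * β * μ)
    (g : E3 → E3) (hg : ContDiff ℝ (⊤ : ℕ∞) g) (hgc : HasCompactSupport g)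
    (hgdiv : ∀ x, (∑ i : Fin 3, pd i (fun y' => g y' i) x) = 0) :
    ∃ Rt Cstar : ℝ, 0 < Rt ∧ 0 < Cstar ∧
      ∀ (y : ℝ → ℝ), Continuous y →
      ∀ (f : ℝ → E3 → E3), Continuous (Function.uncurry f) →
        (∀ t, Integrable (fun x : E3 => ‖f t x‖ ^ 2)) →
      ∀ (u : ℝ → E3 → E3),
        ContDiff ℝ (⊤ : ℕ∞) (fun q : ℝ × E3 => u q.1 q.2) →
        (∀ a b : ℝ, ∃ K : Set E3, IsCompact K ∧
          ∀ t ∈ Set.Icc a b, ∀ x : E3, x ∉ K → u t x = 0) →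
        (∀ t x, (∑ i : Fin 3, pd i (fun y' => u t y' i) x) = 0) →
      ∀ (p : ℝ → E3 → ℝ), (∀ t, ContDiff ℝ 1 (p t)) →
        (∀ (t : ℝ) (x : E3) (j : Fin 3),
          deriv (fun s => u s x j) t - μ * lap (fun y' => u t y' j) x
            + (∑ i : Fin 3, (u t x i + g x i * y t) *
                pd i (fun y' => u t y' j + g y' j * y t) x)
            + α * u t x j
            + β * ‖u t x + y t • g x‖ ^ (r - 1) * (u t x j + g x j * y t)
          = -(pd j (p t) x) + f t x j + (σ - α) * (g x j * y t)
            + μ * y t * lap (fun y' => g y' j) x) →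
      (∀ t : ℝ, DifferentiableAt ℝ (fun s => ∫ x : E3, gradSq (u s) x) t) ∧
      ∀ t : ℝ,
        deriv (fun s => ∫ x : E3, gradSq (u s) x) t
          + α * (∫ x : E3, gradSq (u t) x)
          + Cstar / 2 * (∫ x : E3, ‖u t x + y t • g x‖ ^ (3 * (r + 1))) ^ ((1 : ℝ) / 3)
        ≤ Rt * ((∫ x : E3, ‖f t x‖ ^ 2) + (∫ x : E3, ‖u t x‖ ^ 2)
            + (∫ x : E3, gradSq (u t) x)
            + (∫ x : E3, ‖u t x + y t • g x‖ ^ (r + 1))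
            + |y t| ^ 2 + |y t| ^ (r + 1)) := by
  obtain ⟨K, hK0, hK⟩ := exists_sq_le_rpow_add_const hμ hβ hr hr3
  obtain ⟨C, hC, hsob⟩ := exists_sobolev_norm_rpow_const hr
  set Gg := ∫ x, gradSq g x
  set M := ∫ x, ‖vecLap g x‖ ^ (r + 1)
  set M₂ := ∫ x, ‖vecLap g x‖ ^ 2
  set N₂ := ∫ x, ‖g x‖ ^ 2
  have hGg : 0 ≤ Gg := integral_nonneg fun x => gradSq_nonneg g x
  have hM : 0 ≤ M := integral_nonneg fun x => by positivity
  have hM₂ : 0 ≤ M₂ := integral_nonneg fun x => by positivity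
  have hN₂ : 0 ≤ N₂ := integral_nonneg fun x => by positivity
  have hr1 : 0 < r - 1 := by linarith
  set cf := 3 / μ with hcf
  set cy := 4 * K * Gg + cf * ((σ - α) ^ 2 * N₂ + μ ^ 2 * M₂) with hcy
  have hcf0 : 0 < cf := by positivity
  have hcy0 : 0 ≤ cy := by positivity
  refine ⟨cf + 4 * K + 2 * β + cy + 2 * β * M, 4 * β * (r - 1) / C, by positivity, by positivity,
    fun y _ f _ hfi u hu hsupp hudiv p hp heq => ?_⟩
  have hder (t : ℝ) : HasDerivAt (fun s => ∫ x, gradSq (u s) x)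
      (2 * ∫ x, ∑ i : Fin 3, ∑ j : Fin 3,
        pd i (fun y => deriv (fun s => u s y j) t) x * pd i (fun y => u t y j) x) t := by
    obtain ⟨S, hS, h0⟩ := hsupp (t - 1) (t + 1)
    exact hasDerivAt_integral_gradSq hu hS h0
  refine ⟨fun t => (hder t).differentiableAt, fun t => ?_⟩
  have hut : ContDiff ℝ (⊤ : ℕ∞) (u t) := hu.comp (contDiff_const.prodMk contDiff_id)
  have huc : HasCompactSupport (u t) := by
    obtain ⟨S, hS, h0⟩ := hsupp t t
    exact HasCompactSupport.intro hS fun x hx => h0 t ⟨le_rfl, le_rfl⟩ x hx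
  have hw : ContDiff ℝ 1
      fun x => (WithLp.toLp 2 fun j => deriv (fun s => u s x j) t : E3) :=
    contDiff_euclidean.2 fun j => (contDiff_deriv_time hu t j).of_le (by simp)
  have hmain := gradient_energy_estimate hμ hβ hr hK0 hK (y t) hg hgc hut huc (hudiv t) hw
    (hfi t) (hp t) (heq t)
  have hS := hsob (fun x => u t x + y t • g x)
    ((hut.add (hg.const_smul (y t))).of_le (by simp)) (huc.add_const_smul hgc (y t))
  rw [(hder t).deriv]
  set A := ∫ x, ∑ i : Fin 3, ∑ j : Fin 3,
    pd i (fun z => deriv (fun s => u s z j) t) x * pd i (fun z => u t z j) x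
  set G := ∫ x, gradSq (u t) x
  set Q := ∫ x, ‖u t x + y t • g x‖ ^ (r - 3) * radialGradSq (fun x => u t x + y t • g x) x
  set Fsq := ∫ x, ‖f t x‖ ^ 2
  set Usq := ∫ x, ‖u t x‖ ^ 2
  set V := ∫ x, ‖u t x + y t • g x‖ ^ (r + 1)
  set S := (∫ x, ‖u t x + y t • g x‖ ^ (3 * (r + 1))) ^ ((1 : ℝ) / 3)
  set Y := |y t| ^ (r + 1)
  have hG : 0 ≤ G := integral_nonneg fun x => gradSq_nonneg (u t) x
  have hF : 0 ≤ Fsq := integral_nonneg fun x => by positivity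
  have hU : 0 ≤ Usq := integral_nonneg fun x => by positivity
  have hV : 0 ≤ V := integral_nonneg fun x => by positivity
  have hY : 0 ≤ Y := by positivity
  have hdamp : 4 * β * (r - 1) / C / 2 * S ≤ 2 * β * (r - 1) * Q := by
    calc 4 * β * (r - 1) / C / 2 * S ≤ 4 * β * (r - 1) / C / 2 * (C * Q) := by gcongr
      _ = 2 * β * (r - 1) * Q := by field_simp; ring
  have hcoef {c d X : ℝ} (hd : 0 ≤ d) (hX : 0 ≤ X)
      (h : c + d = cf + 4 * K + 2 * β + cy + 2 * β * M) :
      c * X ≤ (cf + 4 * K + 2 * β + cy + 2 * β * M) * X :=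
    mul_le_mul_of_nonneg_right (by linarith) hX
  have b1 := hcoef (c := cf) (d := 4 * K + 2 * β + cy + 2 * β * M) (by positivity) hF (by ring)
  have b2 := hcoef (c := 4 * K) (d := cf + 2 * β + cy + 2 * β * M) (by positivity) hG (by ring)
  have b3 := hcoef (c := 2 * β) (d := cf + 4 * K + cy + 2 * β * M) (by positivity) hV (by ring)
  have b4 := hcoef (c := cy) (d := cf + 4 * K + 2 * β + 2 * β * M) (by positivity)
    (sq_nonneg |y t|) (by ring)
  have b5 := hcoef (c := 2 * β * M) (d := cf + 4 * K + 2 * β + cy) (by positivity) hY (by ring)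
  have b6 := hcoef (c := 0) (d := cf + 4 * K + 2 * β + cy + 2 * β * M) (by positivity) hU (by ring)
  have hαG : 0 ≤ α * G := by positivity
  have hcf2 : 3 / (2 * μ) = cf / 2 := by rw [hcf]; field_simp
  rw [hcf2, ← sq_abs (y t)] at hmain
  rw [hcy] at b4
  linarith

end
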